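/- arXiv:1707.07488 — 2 statements merged into one kernel-verified Lean document; each statement's English description precedes it below -/
import Mathlib

section
/- Fix an integer s ≥ 2 and γ ∈ [0,1]. The following are equivalent: (i) there exists k ≥ 1 with g^k(γ) < γ; (ii) Q_γ satisfies the matching condition for some matching exponents κ⁻, κ⁺ ≥ 1 and γ ∉ PM_γ. Consequently the bifurcation set, i.e. the set of γ ∈ [0,1] for which (ii) fails, equals E = {γ ∈ [0,1] : g^k(γ) ≥ γ for all k ≥ 1}. -/
/-- The piecewise affine map `Q_γ(x) = x + 1` for `x ≤ γ` and `Q_γ(x) = 1 + s(1 - x)` for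
`x > γ`. -/
noncomputable def Q (s γ : ℝ) (x : ℝ) : ℝ := if x ≤ γ then x + 1 else 1 + s * (1 - x)

/-- The lower orbit `ℓ_j = Q_γ^j(γ + 1)`. -/
noncomputable def lowerOrbit (s γ : ℝ) (j : ℕ) : ℝ := (Q s γ)^[j] (γ + 1)

/-- The upper orbit `u_j = Q_γ^j(1 + s(1 - γ))`. -/
noncomputable def upperOrbit (s γ : ℝ) (j : ℕ) : ℝ := (Q s γ)^[j] (1 + s * (1 - γ))

open Classical in
/-- `Q_γ` satisfies the matching condition with matching exponents `κ⁻ = km ≥ 1`,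
`κ⁺ = kp ≥ 1`. -/
noncomputable def Matches (s γ : ℝ) (km kp : ℕ) : Prop :=
  1 ≤ km ∧ 1 ≤ kp ∧
  lowerOrbit s γ (km - 1) = upperOrbit s γ (kp - 1) ∧
  ((Finset.range (km - 1)).filter (fun j => γ < lowerOrbit s γ j)).card
    = 1 + ((Finset.range (kp - 1)).filter (fun j => γ < upperOrbit s γ j)).card

/-- The prematching set `PM_γ = {ℓ_j : 0 ≤ j ≤ κ⁻ − 2} ∪ {u_j : 0 ≤ j ≤ κ⁺ − 2}`. -/
noncomputable def PMset (s γ : ℝ) (km kp : ℕ) : Set ℝ :=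
  {x | ∃ j : ℕ, j + 2 ≤ km ∧ x = lowerOrbit s γ j} ∪
  {x | ∃ j : ℕ, j + 2 ≤ kp ∧ x = upperOrbit s γ j}

/-- The map `g(x) = s(1 − x) mod 1`. -/
noncomputable def gmap (s : ℕ) (x : ℝ) : ℝ := Int.fract ((s : ℝ) * (1 - x))

/-- The bifurcation set `E = {γ ∈ [0,1] : g^k(γ) ≥ γ for all k ≥ 1}`. -/
noncomputable def Eset (s : ℕ) : Set ℝ :=
  {γ ∈ Set.Icc (0 : ℝ) 1 | ∀ k : ℕ, 1 ≤ k → γ ≤ (gmap s)^[k] γ}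

/-- The number of the first `n` points of the `Q_γ`-orbit of `x` that lie to the right of `γ`. -/
noncomputable def visits (s γ x : ℝ) (n : ℕ) : ℕ :=
  ∑ j ∈ Finset.range n, if γ < (Q s γ)^[j] x then 1 else 0

lemma visits_zero (s γ x : ℝ) : visits s γ x 0 = 0 := rfl

lemma visits_succ (s γ x : ℝ) (n : ℕ) :
    visits s γ x (n + 1) = visits s γ (Q s γ x) n + if γ < x then 1 else 0 := by
  simp only [visits, Finset.sum_range_succ', Function.iterate_succ_apply, Function.iterate_zero,
    id_eq]
  rfl

lemma card_filter_iterate (s γ x : ℝ) (n : ℕ) [DecidablePred fun j => γ < (Q s γ)^[j] x] :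
    ((Finset.range n).filter (fun j => γ < (Q s γ)^[j] x)).card = visits s γ x n := by
  rw [Finset.card_filter, visits]
  congr! 2

lemma Q_of_lt {s γ x : ℝ} (h : x < γ) : Q s γ x = x + 1 := if_pos h.le

lemma Q_of_gt {s γ x : ℝ} (h : γ < x) : Q s γ x = 1 + s * (1 - x) := if_neg h.not_ge

/-- The orbits of `x` and `y` under `Q_γ` merge with equal derivatives, without visiting `γ`
before merging. -/
inductive Merges (s γ : ℝ) : ℝ → ℝ → Prop
  | refl (x : ℝ) : Merges s γ x x
  | left {x y : ℝ} : x < γ → Merges s γ (x + 1) y → Merges s γ x y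
  | right {x y : ℝ} : y < γ → Merges s γ x (y + 1) → Merges s γ x y
  | both {x y : ℝ} : γ < x → γ < y → Merges s γ (1 + s * (1 - x)) (1 + s * (1 - y)) →
      Merges s γ x y

/-- The orbits of `x` and `y` merge at times `m` and `n` with equal derivatives, without visiting
`γ` before. -/
def MergesAt (s γ x y : ℝ) (m n : ℕ) : Prop :=
  (Q s γ)^[m] x = (Q s γ)^[n] y ∧ visits s γ x m = visits s γ y n ∧
    (∀ j < m, (Q s γ)^[j] x ≠ γ) ∧ ∀ j < n, (Q s γ)^[j] y ≠ γ

lemma forall_iterate_ne_succ (s γ x : ℝ) (m : ℕ) :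
    (∀ j < m + 1, (Q s γ)^[j] x ≠ γ) ↔ x ≠ γ ∧ ∀ j < m, (Q s γ)^[j] (Q s γ x) ≠ γ := by
  rw [Nat.forall_lt_succ_left]
  simp

lemma Merges.exists_mergesAt {s γ x y : ℝ} (h : Merges s γ x y) :
    ∃ m n, MergesAt s γ x y m n := by
  induction h with
  | refl x => exact ⟨0, 0, rfl, rfl, by simp, by simp⟩
  | @left x y hx _ ih =>
    obtain ⟨m, n, h1, h2, h3, h4⟩ := ih
    refine ⟨m + 1, n, ?_, ?_, ?_, h4⟩
    · rwa [Function.iterate_succ_apply, Q_of_lt hx]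
    · rwa [visits_succ, Q_of_lt hx, if_neg hx.not_gt, add_zero]
    · rw [forall_iterate_ne_succ, Q_of_lt hx]
      exact ⟨hx.ne, h3⟩
  | @right x y hy _ ih =>
    obtain ⟨m, n, h1, h2, h3, h4⟩ := ih
    refine ⟨m, n + 1, ?_, ?_, h3, ?_⟩
    · rwa [Function.iterate_succ_apply, Q_of_lt hy]
    · rwa [visits_succ, Q_of_lt hy, if_neg hy.not_gt, add_zero]
    · rw [forall_iterate_ne_succ, Q_of_lt hy]
      exact ⟨hy.ne, h4⟩
  | @both x y hx hy _ ih =>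
    obtain ⟨m, n, h1, h2, h3, h4⟩ := ih
    refine ⟨m + 1, n + 1, ?_, ?_, ?_, ?_⟩
    · rwa [Function.iterate_succ_apply, Function.iterate_succ_apply, Q_of_gt hx, Q_of_gt hy]
    · rw [visits_succ, visits_succ, Q_of_gt hx, Q_of_gt hy, if_pos hx, if_pos hy, h2]
    · rw [forall_iterate_ne_succ, Q_of_gt hx]
      exact ⟨hx.ne', h3⟩
    · rw [forall_iterate_ne_succ, Q_of_gt hy]
      exact ⟨hy.ne', h4⟩

lemma MergesAt.merges {s γ : ℝ} :
    ∀ {m n : ℕ} {x y : ℝ}, MergesAt s γ x y m n → Merges s γ x y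
  | 0, 0, x, y, ⟨h, _⟩ => by
    obtain rfl : x = y := h
    exact .refl x
  | m + 1, 0, x, y, ⟨h1, h2, h3, h4⟩ => by
    rw [forall_iterate_ne_succ] at h3
    rw [visits_succ, visits_zero] at h2
    have hx : x < γ := by
      refine lt_of_le_of_ne (not_lt.1 fun hx => ?_) h3.1
      simp [hx] at h2
    rw [if_neg hx.not_gt, Q_of_lt hx] at h2
    rw [Function.iterate_succ_apply, Q_of_lt hx] at h1
    rw [Q_of_lt hx] at h3
    exact .left hx (MergesAt.merges (m := m) (n := 0) ⟨h1, h2, h3.2, h4⟩)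
  | 0, n + 1, x, y, ⟨h1, h2, h3, h4⟩ => by
    rw [forall_iterate_ne_succ] at h4
    rw [visits_succ, visits_zero] at h2
    have hy : y < γ := by
      refine lt_of_le_of_ne (not_lt.1 fun hy => ?_) h4.1
      simp [hy] at h2
    rw [if_neg hy.not_gt, Q_of_lt hy] at h2
    rw [Function.iterate_succ_apply, Q_of_lt hy] at h1
    rw [Q_of_lt hy] at h4
    exact .right hy (MergesAt.merges (m := 0) (n := n) ⟨h1, h2, h3, h4.2⟩)
  | m + 1, n + 1, x, y, ⟨h1, h2, h3, h4⟩ => by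
    have h3' := (forall_iterate_ne_succ _ _ _ _).1 h3
    have h4' := (forall_iterate_ne_succ _ _ _ _).1 h4
    rcases lt_or_gt_of_ne h3'.1 with hx | hx
    · rw [visits_succ, if_neg hx.not_gt, Q_of_lt hx] at h2
      rw [Function.iterate_succ_apply, Q_of_lt hx] at h1
      rw [Q_of_lt hx] at h3'
      exact .left hx (MergesAt.merges (m := m) (n := n + 1) ⟨h1, h2, h3'.2, h4⟩)
    · rcases lt_or_gt_of_ne h4'.1 with hy | hy
      · rw [visits_succ s γ y, if_neg hy.not_gt, Q_of_lt hy] at h2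
        rw [Function.iterate_succ_apply (Q s γ) n y, Q_of_lt hy] at h1
        rw [Q_of_lt hy] at h4'
        exact .right hy (MergesAt.merges (m := m + 1) (n := n) ⟨h1, h2, h3, h4'.2⟩)
      · rw [visits_succ, visits_succ, if_pos hx, if_pos hy, Q_of_gt hx, Q_of_gt hy] at h2
        rw [Function.iterate_succ_apply, Function.iterate_succ_apply, Q_of_gt hx,
          Q_of_gt hy] at h1
        rw [Q_of_gt hx] at h3'
        rw [Q_of_gt hy] at h4'
        exact .both hx hy
          (MergesAt.merges (m := m) (n := n) ⟨h1, by omega, h3'.2, h4'.2⟩)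

/-- Matching without `γ` in the prematching set is merging of `Q_γ(γ + 1)` and `Q_γ(γ⁺)`. -/
lemma exists_matches_iff_merges (s γ : ℝ) :
    (∃ km kp : ℕ, Matches s γ km kp ∧ γ ∉ PMset s γ km kp) ↔
      Merges s γ (1 - s * γ) (1 + s * (1 - γ)) := by
  have hγ : γ < γ + 1 := by linarith
  have hQ : Q s γ (γ + 1) = 1 - s * γ := by rw [Q_of_gt hγ]; ring
  have hl (m : ℕ) : lowerOrbit s γ (m + 1) = (Q s γ)^[m] (1 - s * γ) := by
    rw [lowerOrbit, Function.iterate_succ_apply, hQ]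
  have hcl (m : ℕ) : visits s γ (γ + 1) (m + 1) = visits s γ (1 - s * γ) m + 1 := by
    rw [visits_succ, hQ, if_pos hγ]
  constructor
  · rintro ⟨km, kp, ⟨hkm, hkp, h1, h2⟩, hPM⟩
    obtain ⟨m, rfl⟩ := Nat.exists_eq_add_of_le' hkm
    obtain ⟨n, rfl⟩ := Nat.exists_eq_add_of_le' hkp
    simp only [Nat.add_sub_cancel, lowerOrbit, upperOrbit, card_filter_iterate] at h1 h2
    cases m with
    | zero => rw [visits_zero] at h2; omega
    | succ m =>
      rw [hcl] at h2
      rw [← lowerOrbit] at h1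
      rw [hl] at h1
      refine MergesAt.merges (m := m) (n := n) ⟨h1, by omega, fun j hj h => ?_, fun j hj h => ?_⟩
      · exact hPM (Or.inl ⟨j + 1, by omega, by rw [hl, h]⟩)
      · exact hPM (Or.inr ⟨j, by omega, h.symm⟩)
  · intro h
    obtain ⟨m, n, h1, h2, h3, h4⟩ := h.exists_mergesAt
    refine ⟨m + 2, n + 1, ⟨by omega, by omega, ?_, ?_⟩, ?_⟩
    · exact (hl m).trans h1
    · refine (card_filter_iterate s γ (γ + 1) (m + 1)).trans ((hcl m).trans ?_)
      rw [h2, add_comm]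
      exact congrArg (1 + ·) (card_filter_iterate s γ (1 + s * (1 - γ)) n).symm
    · rintro (⟨j, hj, h⟩ | ⟨j, hj, h⟩)
      · cases j with
        | zero => exact hγ.ne h
        | succ j => exact h3 j (by omega) (by rw [← hl, ← h])
      · exact h4 j (by omega) h.symm

lemma Merges.symm {s γ x y : ℝ} (h : Merges s γ x y) : Merges s γ y x := by
  induction h with
  | refl x => exact .refl x
  | left hx _ ih => exact .right hx ih
  | right hy _ ih => exact .left hy ih
  | both hx hy _ ih => exact .both hy hx ih

lemma Merges.sub_natCast {s γ x y : ℝ} (h : Merges s γ x y) (hx : x - 1 < γ) (N : ℕ) :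
    Merges s γ (x - N) y := by
  induction N with
  | zero => simpa using h
  | succ N ih =>
    refine .left ?_ ?_
    · push_cast
      linarith [N.cast_nonneg (α := ℝ)]
    · convert ih using 1
      push_cast
      ring

lemma gmap_nonneg (s : ℕ) (x : ℝ) : 0 ≤ gmap s x := Int.fract_nonneg _

lemma gmap_lt_one (s : ℕ) (x : ℝ) : gmap s x < 1 := Int.fract_lt_one _

/-- The integer part of `s(1 - q)` for `q ≤ 1`. -/
lemma exists_eq_gmap_add (s : ℕ) {q : ℝ} (hq : q ≤ 1) :
    ∃ m : ℕ, (s : ℝ) * (1 - q) = gmap s q + m := by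
  have h : (0 : ℝ) ≤ s * (1 - q) := mul_nonneg s.cast_nonneg (by linarith)
  obtain ⟨m, hm⟩ := Int.eq_ofNat_of_zero_le (Int.floor_nonneg.2 h)
  refine ⟨m, ?_⟩
  have := Int.fract_add_floor ((s : ℝ) * (1 - q))
  rw [hm] at this
  exact this.symm

/-- For `0 < q` that integer part is less than `s`. -/
lemma lt_of_eq_gmap_add {s : ℕ} (hs : 2 ≤ s) {q : ℝ} (hq : 0 < q) {m : ℕ}
    (h : (s : ℝ) * (1 - q) = gmap s q + m) : m < s := by
  have hs' : (2 : ℝ) ≤ s := by exact_mod_cast hs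
  have : (m : ℝ) < s := by nlinarith [gmap_nonneg s q]
  exact_mod_cast this

lemma merges_of_gIter_lt {s : ℕ} (hs : 2 ≤ s) {γ : ℝ} (h0 : 0 < γ) (k : ℕ) :
    ∀ {q : ℝ} {N : ℕ}, γ ≤ q → q ≤ 1 → 1 ≤ N → (∀ i < k, γ < (gmap s)^[i + 1] q) →
      (gmap s)^[k + 1] q < γ →
      Merges s γ (1 + s * (1 - q) - s * N) (1 + s * (1 - q)) := by
  induction k with
  | zero =>
    intro q N hq hq1 hN _ hlt
    replace hlt : gmap s q < γ := hlt
    obtain ⟨m, hm⟩ := exists_eq_gmap_add s hq1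
    have hms := lt_of_eq_gmap_add hs (h0.trans_le hq) hm
    have hp := gmap_nonneg s q
    obtain ⟨L, hL⟩ := Nat.exists_eq_add_of_le (hms.le.trans (Nat.le_mul_of_pos_right s hN))
    have hL' : (s : ℝ) * N = m + L := by exact_mod_cast hL
    rw [hm]
    rcases Nat.eq_zero_or_pos m with rfl | hm0
    · rw [hL']
      convert (Merges.refl (s := s) (γ := γ) (1 + (gmap s q + (0 : ℕ)))).sub_natCast ?_ L using 1
      · push_cast; ring
      · push_cast; linarith
    · have hm1 : (1 : ℝ) ≤ m := by exact_mod_cast hm0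
      have hs' : (2 : ℝ) ≤ s := by exact_mod_cast hs
      have hγ1 : γ < 1 := by
        by_contra! h
        obtain rfl : q = 1 := by linarith
        linarith
      have hsp : (0 : ℝ) ≤ s * gmap s q := by positivity
      have key : Merges s γ (1 + gmap s q) (1 + (gmap s q + m)) := by
        refine .both (by linarith) (by linarith) (Merges.symm ?_)
        convert (Merges.refl (s := s) (γ := γ) (1 - s * gmap s q)).sub_natCast ?_ (s * m) using 1
        · push_cast; ring
        · ring
        · linarith
      convert key.sub_natCast (by linarith) L using 1
      linarith
  | succ k ih =>
    intro q N hq hq1 hN hgt hlt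
    obtain ⟨m, hm⟩ := exists_eq_gmap_add s hq1
    have hms := lt_of_eq_gmap_add hs (h0.trans_le hq) hm
    have hpγ : γ < gmap s q := hgt 0 (by omega)
    have hp1 := gmap_lt_one s q
    obtain ⟨L, hL⟩ := Nat.exists_eq_add_of_le
      ((Nat.succ_le_of_lt hms).trans (Nat.le_mul_of_pos_right s hN))
    have hL' : (s : ℝ) * N = m + 1 + L := by exact_mod_cast hL
    have hrec := ih (q := gmap s q) (N := m + 1) hpγ.le hp1.le (by omega)
      (fun i hi => hgt (i + 1) (by omega)) hlt
    have key : Merges s γ (gmap s q) (1 + (gmap s q + m)) := by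
      refine .both hpγ (by linarith [m.cast_nonneg (α := ℝ)]) (Merges.symm ?_)
      convert hrec using 1
      push_cast; ring
    rw [hm]
    convert key.sub_natCast (by linarith) L using 1
    linarith

/-- Pairs `p - N`, `p + m` with `m ≥ 1` where the `g`-orbit of `p` stays in `[γ, 1)`. -/
def Separated (s : ℕ) (γ x y : ℝ) : Prop :=
  ∃ (p : ℝ) (m N : ℕ), p < 1 ∧ (∀ k, γ ≤ (gmap s)^[k] p) ∧ x = p - N ∧ y = p + m + 1

lemma separated_affine {s : ℕ} (hs : 2 ≤ s) {γ p y : ℝ} (hp : 0 < p) (hp1 : p ≤ 1)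
    (h : ∀ k, γ ≤ (gmap s)^[k + 1] p) {m : ℕ} (hy : y = p + m + 1) :
    Separated s γ (1 + s * (1 - y)) (1 + s * (1 - p)) := by
  obtain ⟨n, hn⟩ := exists_eq_gmap_add s hp1
  have hns := lt_of_eq_gmap_add hs hp hn
  obtain ⟨L, hL⟩ := Nat.exists_eq_add_of_le
    ((Nat.succ_le_of_lt hns).trans (Nat.le_mul_of_pos_right s m.succ_pos))
  have hL' : (s : ℝ) * (m + 1) = n + 1 + L := by exact_mod_cast hL
  refine ⟨gmap s p, n, L, gmap_lt_one s p, h, ?_, by linarith⟩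
  rw [hy]
  linarith

lemma Separated.add_one {s : ℕ} {γ x y : ℝ} (h : Separated s γ x y) (hx : x < γ) :
    Separated s γ (x + 1) y := by
  obtain ⟨p, m, N, hp, hk, rfl, hy⟩ := h
  cases N with
  | zero =>
    have := hk 0
    simp at this hx
    linarith
  | succ N => exact ⟨p, m, N, hp, hk, by push_cast; ring, hy⟩

lemma Separated.le_right {s : ℕ} {γ x y : ℝ} (h : Separated s γ x y) : γ ≤ y := by
  obtain ⟨p, m, N, hp, hk, rfl, rfl⟩ := h
  have : γ ≤ p := hk 0
  linarith [m.cast_nonneg (α := ℝ)]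

lemma Separated.affine {s : ℕ} (hs : 2 ≤ s) {γ x y : ℝ} (hγ : 0 ≤ γ) (h : Separated s γ x y)
    (hx : γ < x) : Separated s γ (1 + s * (1 - y)) (1 + s * (1 - x)) := by
  obtain ⟨p, m, N, hp, hk, rfl, hy⟩ := h
  cases N with
  | zero =>
    simp only [Nat.cast_zero, sub_zero] at hx ⊢
    exact separated_affine hs (hγ.trans_lt hx) hp.le (fun k => hk (k + 1)) hy
  | succ N =>
    push_cast at hx
    linarith [N.cast_nonneg (α := ℝ)]

lemma Merges.not_separated {s : ℕ} (hs : 2 ≤ s) {γ x y : ℝ} (hγ : 0 ≤ γ)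
    (h : Merges s γ x y) : ¬ Separated s γ x y ∧ ¬ Separated s γ y x := by
  induction h with
  | refl x =>
    rw [and_self]
    rintro ⟨p, m, N, -, -, h1, h2⟩
    linarith [m.cast_nonneg (α := ℝ), N.cast_nonneg (α := ℝ)]
  | left hx _ ih => exact ⟨fun h => ih.1 (h.add_one hx), fun h => h.le_right.not_gt hx⟩
  | right hy _ ih => exact ⟨fun h => h.le_right.not_gt hy, fun h => ih.2 (h.add_one hy)⟩
  | both hx hy _ ih =>
    exact ⟨fun h => ih.2 (h.affine hs hγ hx), fun h => ih.1 (h.affine hs hγ hy)⟩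

lemma not_merges_zero {s : ℕ} (hs : 2 ≤ s) : ¬ Merges s 0 1 (1 + s) := by
  have hs' : (2 : ℝ) ≤ s := by exact_mod_cast hs
  generalize hx : (1 : ℝ) = x
  generalize hy : x + s = y
  rintro (_ | ⟨h, -⟩ | ⟨h, -⟩ | ⟨-, -, h⟩)
  · linarith
  · linarith
  · linarith
  · obtain ⟨L, hL⟩ := Nat.exists_eq_add_of_le (show 1 ≤ s * s by nlinarith)
    have hL' : (s : ℝ) * s = 1 + L := by exact_mod_cast hL
    refine (h.not_separated hs le_rfl).2 ⟨0, 0, L, one_pos, fun k => ?_, ?_, ?_⟩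
    · cases k with
      | zero => exact le_rfl
      | succ k =>
        rw [Function.iterate_succ_apply']
        exact gmap_nonneg s _
    · subst hy hx
      linarith
    · subst hx
      simp

lemma exists_gIter_lt_iff (s : ℕ) (hs : 2 ≤ s) (γ : ℝ) (hγ : γ ∈ Set.Icc (0 : ℝ) 1) :
    (∃ k : ℕ, 1 ≤ k ∧ (gmap s)^[k] γ < γ) ↔
      ∃ km kp : ℕ, Matches s γ km kp ∧ γ ∉ PMset s γ km kp := by
  rw [exists_matches_iff_merges]
  constructor
  · intro h
    replace h : ∃ k : ℕ, (gmap s)^[k + 1] γ < γ := by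
      obtain ⟨k, hk, hlt⟩ := h
      exact ⟨k - 1, by rwa [Nat.sub_add_cancel hk]⟩
    classical
    have hlt := Nat.find_spec h
    have hmin := fun i hi => not_lt.1 (Nat.find_min h (m := i) hi)
    have h0 : 0 < γ := by
      refine lt_of_le_of_lt ?_ hlt
      rw [Function.iterate_succ_apply']
      exact gmap_nonneg s _
    have := merges_of_gIter_lt hs h0 (Nat.find h) le_rfl hγ.2 le_rfl (fun i hi => ?_) hlt
    · convert this using 1
      push_cast; ring
    · refine lt_of_le_of_ne (hmin i hi) fun heq => ?_
      have hlt' := hlt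
      rw [show Nat.find h + 1 = (Nat.find h - (i + 1) + 1) + (i + 1) by omega,
        Function.iterate_add_apply, ← heq] at hlt'
      exact (hmin _ (by omega)).not_gt hlt'
  · intro h
    by_contra! hge
    rcases hγ.1.eq_or_lt with rfl | h0
    · refine not_merges_zero hs ?_
      simpa using h
    · refine (h.not_separated hs h0.le).1 ?_
      have := separated_affine hs h0 hγ.2 (fun k => hge (k + 1) (by omega)) (m := 0) rfl
      convert this using 1
      push_cast; ring

/-- for integer slope `s ≥ 2` and `γ ∈ [0,1]`, the matching of `Q_γ` (with some
matching exponents and `γ ∉ PM_γ`) is equivalent to `g^k(γ) < γ` for some `k ≥ 1`;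
consequently the bifurcation set, the set of parameters where matching (with stability) fails,
is `E = {γ ∈ [0,1] : g^k(γ) ≥ γ for all k ≥ 1}`. -/
theorem matching_iff_gIter_lt (s : ℕ) (hs : 2 ≤ s) (γ : ℝ) (hγ : γ ∈ Set.Icc (0 : ℝ) 1) :
    ((∃ k : ℕ, 1 ≤ k ∧ (gmap s)^[k] γ < γ) ↔
      (∃ km kp : ℕ, Matches s γ km kp ∧ γ ∉ PMset s γ km kp)) ∧
    Eset s = {γ' ∈ Set.Icc (0 : ℝ) 1 |
      ¬ ∃ km kp : ℕ, Matches s γ' km kp ∧ γ' ∉ PMset s γ' km kp} := by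
  refine ⟨exists_gIter_lt_iff s hs γ hγ, ?_⟩
  ext γ'
  refine and_congr_right fun hγ' => ?_
  rw [← exists_gIter_lt_iff s hs γ' hγ']
  push Not
  rfl
end

section
/- Fix an integer s ≥ 2 and let J = (c, d) be a connected component of [0, s/(s+1)] \ E. Then J contains a unique s-adic rational ξ of minimal denominator (a unique ξ = p/s^m ∈ J with m minimal among all elements of ℚ_s ∩ J). Moreover: (i) c = ξ_L and d = ξ_R, where ξ_L, ξ_R are defined from the shortest even-length expansion w of ξ and the shortest odd-length expansion v of 1 − ξ; (ii) g^k(ξ) ∉ (0, d) for all k ≥ 1; (iii) if ξ′ ∈ ℚ_s ∩ J satisfies g^k(ξ′) ∉ (0, ξ′) for all k ≥ 1, then ξ′ = ξ. -/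
/-- The value `.w = Σ εᵢ s^{-i}` of a finite word of digits in base `s`. -/
noncomputable def sval (s : ℕ) (w : List ℕ) : ℝ :=
  w.foldr (fun d r => ((d : ℝ) + r) / s) 0

/-- The value `.\overline{w}` of the purely periodic base-`s` expansion repeating `w`. -/
noncomputable def pval (s : ℕ) (w : List ℕ) : ℝ :=
  sval s w * (s : ℝ) ^ w.length / ((s : ℝ) ^ w.length - 1)

/-- Digit-wise flip `ε ↦ s − 1 − ε` of a word. -/
def flipw (s : ℕ) (w : List ℕ) : List ℕ := w.map (fun d => s - 1 - d)

/-- `w` is the shortest base-`s` expansion of `x` of even length. -/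
noncomputable def IsEvenExp (s : ℕ) (x : ℝ) (w : List ℕ) : Prop :=
  w ≠ [] ∧ (∀ d ∈ w, d < s) ∧ Even w.length ∧ sval s w = x ∧
  ∀ w' : List ℕ, (∀ d ∈ w', d < s) → Even w'.length → sval s w' = x →
    w.length ≤ w'.length

/-- `v` is the shortest base-`s` expansion of `x` of odd length. -/
noncomputable def IsOddExp (s : ℕ) (x : ℝ) (v : List ℕ) : Prop :=
  (∀ d ∈ v, d < s) ∧ Odd v.length ∧ sval s v = x ∧
  ∀ v' : List ℕ, (∀ d ∈ v', d < s) → Odd v'.length → sval s v' = x →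
    v.length ≤ v'.length

/-- `x` is an `s`-adic rational `p/s^m`. -/
def IsSAdic (s : ℕ) (x : ℝ) : Prop := ∃ p m : ℕ, x = (p : ℝ) / (s : ℝ) ^ m

/-- `m` is the minimal exponent with `x = p/s^m` for some integer `p`. -/
def MinDen (s : ℕ) (x : ℝ) (m : ℕ) : Prop :=
  (∃ p : ℕ, x = (p : ℝ) / (s : ℝ) ^ m) ∧
  ∀ n : ℕ, (∃ p : ℕ, x = (p : ℝ) / (s : ℝ) ^ n) → m ≤ n

theorem gmap_iterate (s : ℕ) (x : ℝ) {k : ℕ} (hk : 1 ≤ k) :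
    (gmap s)^[k] x = Int.fract ((-(s : ℝ)) ^ k * x) := by
  induction k, hk using Nat.le_induction with
  | base =>
    simp only [Function.iterate_one, gmap, pow_one]
    exact Int.fract_eq_fract.2 ⟨s, by push_cast; ring⟩
  | succ k hk ih =>
    rw [Function.iterate_succ_apply', ih, gmap]
    refine Int.fract_eq_fract.2 ⟨s + s * ⌊(-(s : ℝ)) ^ k * x⌋, ?_⟩
    rw [Int.fract]
    push_cast
    ring

theorem mem_Eset_iff (s : ℕ) (x : ℝ) :
    x ∈ Eset s ↔ x ∈ Set.Icc (0 : ℝ) 1 ∧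
      ∀ k : ℕ, 1 ≤ k → x ≤ Int.fract ((-(s : ℝ)) ^ k * x) := by
  refine and_congr_right fun _ => forall₂_congr fun k hk => ?_
  rw [gmap_iterate s x hk]

theorem fract_le_of_sub_eq_int {a b : ℝ} (hb : 0 ≤ b) {z : ℤ} (h : a - b = z) :
    Int.fract a ≤ b := by
  rw [Int.fract_eq_fract.2 ⟨z, h⟩]
  have : (0 : ℝ) ≤ ⌊b⌋ := by exact_mod_cast Int.floor_nonneg.2 hb
  rw [Int.fract]
  linarith

/-- On an interval containing no `j / s ^ k`, the inequality `x ≤ g^k(x)` propagates from the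
endpoints to the interior. -/
theorem le_fract_of_endpoints {s : ℕ} (hs : 2 ≤ s) {c d x : ℝ} {k : ℕ}
    (hc : c ≤ Int.fract ((-(s : ℝ)) ^ k * c)) (hd : d ≤ Int.fract ((-(s : ℝ)) ^ k * d))
    (hno : ∀ j : ℤ, (j : ℝ) / (s : ℝ) ^ k ∉ Set.Ioo c d) (hx : x ∈ Set.Ioo c d) :
    x ≤ Int.fract ((-(s : ℝ)) ^ k * x) := by
  have hs1 : (1 : ℝ) ≤ s := by exact_mod_cast (by omega : 1 ≤ s)
  have hp1 : (1 : ℝ) ≤ (s : ℝ) ^ k := one_le_pow₀ hs1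
  have hp : (0 : ℝ) < (s : ℝ) ^ k := by linarith
  obtain ⟨hx1, hx2⟩ := hx
  rcases Nat.even_or_odd k with he | ho
  · rw [he.neg_pow] at hc hd ⊢
    have hj : (⌊(s : ℝ) ^ k * x⌋ : ℝ) ≤ (s : ℝ) ^ k * c := by
      by_contra! h
      refine hno ⌊(s : ℝ) ^ k * x⌋ ⟨?_, lt_of_le_of_lt ?_ hx2⟩
      · rw [lt_div_iff₀ hp]; linarith
      · rw [div_le_iff₀ hp]; linarith [Int.floor_le ((s : ℝ) ^ k * x)]
    have h2 : (⌊(s : ℝ) ^ k * x⌋ : ℝ) ≤ ⌊(s : ℝ) ^ k * c⌋ := by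
      exact_mod_cast Int.le_floor.2 hj
    rw [Int.fract] at hc ⊢
    nlinarith
  · rw [ho.neg_pow] at hc hd ⊢
    have hj : (⌊-(s : ℝ) ^ k * x⌋ : ℝ) ≤ -(s : ℝ) ^ k * d := by
      by_contra! h
      refine hno (-⌊-(s : ℝ) ^ k * x⌋) ⟨lt_of_lt_of_le hx1 ?_, ?_⟩ <;> push_cast
      · rw [le_div_iff₀ hp]; linarith [Int.floor_le (-(s : ℝ) ^ k * x)]
      · rw [div_lt_iff₀ hp]; linarith
    have h2 : (⌊-(s : ℝ) ^ k * x⌋ : ℝ) ≤ ⌊-(s : ℝ) ^ k * d⌋ := by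
      exact_mod_cast Int.le_floor.2 hj
    rw [Int.fract] at hd ⊢
    nlinarith

/-- A point with `(-s)^K x = x + (-s)^K ξ`, where `ξ = z / (-s)^m` and `K ∈ {m, m + 1}`, lies in
`E` as soon as the first `m - 1` defining inequalities hold. -/
theorem mem_Eset_of_periodic {s : ℕ} (hs : 2 ≤ s) {x ξ : ℝ} {m K : ℕ} {z : ℤ}
    (hx0 : 0 < x) (hx1 : x ≤ (s : ℝ) / (s + 1)) (hK : 1 ≤ K) (hmK : m ≤ K) (hKm : K ≤ m + 1)
    (hξ : (-(s : ℝ)) ^ m * ξ = z) (hper : (-(s : ℝ)) ^ K * x = x + (-(s : ℝ)) ^ K * ξ)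
    (hlt : ∀ k, 1 ≤ k → k < m → x ≤ Int.fract ((-(s : ℝ)) ^ k * x)) :
    x ∈ Eset s := by
  have hs2 : (2 : ℝ) ≤ s := by exact_mod_cast hs
  have hxs : x * (s + 1) ≤ s := (le_div_iff₀ (by linarith)).1 hx1
  have hx1' : x < 1 := by nlinarith
  have hint : (-(s : ℝ)) ^ K * ξ = ((-(s : ℤ)) ^ (K - m) * z : ℤ) := by
    push_cast
    rw [← hξ, ← mul_assoc, ← pow_add, Nat.sub_add_cancel hmK]
  refine (mem_Eset_iff s x).2 ⟨⟨hx0.le, hx1'.le⟩, fun k => ?_⟩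
  induction k using Nat.strong_induction_on with
  | _ k ih =>
  intro hk
  rcases lt_trichotomy k K with h | rfl | h
  · rcases lt_or_ge k m with h' | h'
    · exact hlt k hk h'
    · obtain rfl : k = m := by omega
      obtain rfl : K = k + 1 := by omega
      have hfr : Int.fract ((-(s : ℝ)) ^ k * x) = 1 - x / s := by
        have hxd : x / s < 1 := by rw [div_lt_one (by linarith)]; linarith
        have hxd0 : 0 < x / s := by positivity
        refine Int.fract_eq_iff.2 ⟨by linarith, by linarith, z - 1, ?_⟩
        push_cast
        rw [← hξ]
        rw [pow_succ] at hper
        field_simp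
        linarith
      rw [hfr, le_sub_comm, div_le_iff₀ (by linarith)]
      linarith
  · rw [hper, hint, Int.fract_add_intCast, Int.fract_eq_self.2 ⟨hx0.le, hx1'⟩]
  · have hkK : (-(s : ℝ)) ^ k * x =
        (-(s : ℝ)) ^ (k - K) * x + ((-(s : ℤ)) ^ (k - K) * ((-(s : ℤ)) ^ (K - m) * z) : ℤ) := by
      rw [Int.cast_mul _ (_ * z), ← hint]
      push_cast
      rw [← mul_add, ← hper, ← mul_assoc, ← pow_add, Nat.sub_add_cancel h.le]
    rw [hkK, Int.fract_add_intCast]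
    exact ih _ (by omega) (by omega)

theorem neg_pow_mul_div_eq_int {s : ℕ} (hs : 2 ≤ s) (p : ℤ) {m K : ℕ} (h : m ≤ K) :
    ∃ z : ℤ, (-(s : ℝ)) ^ K * ((p : ℝ) / (s : ℝ) ^ m) = z := by
  have hs0 : (s : ℝ) ≠ 0 := by exact_mod_cast (by omega : s ≠ 0)
  refine ⟨(-1) ^ K * s ^ (K - m) * p, ?_⟩
  obtain ⟨e, rfl⟩ := Nat.exists_eq_add_of_le h
  rw [neg_pow, Nat.add_sub_cancel_left, pow_add (s : ℝ)]
  push_cast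
  field_simp

/-- The endpoints of a gap of `E` are determined by its element `ξ` of minimal denominator. -/
theorem gap_endpoints {s : ℕ} (hs : 2 ≤ s) {c d ξ : ℝ} {m M N p : ℕ}
    (hc0 : 0 ≤ c) (hd1 : d ≤ (s : ℝ) / (s + 1)) (hc : c ∈ Eset s) (hd : d ∈ Eset s)
    (hgap : ∀ x ∈ Set.Ioo c d, x ∉ Eset s) (hξ : ξ = (p : ℝ) / (s : ℝ) ^ m)
    (hξJ : ξ ∈ Set.Ioo c d)
    (hmin : ∀ k < m, ∀ j : ℤ, (j : ℝ) / (s : ℝ) ^ k ∉ Set.Ioo c d)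
    (hM : Odd M) (hmM : m ≤ M) (hMm : M ≤ m + 1)
    (hN : Even N) (hN0 : 1 ≤ N) (hmN : m ≤ N) (hNm : N ≤ m + 1) :
    c = ξ * (s : ℝ) ^ M / ((s : ℝ) ^ M + 1) ∧ d = ξ * (s : ℝ) ^ N / ((s : ℝ) ^ N - 1) := by
  have hs1 : (1 : ℝ) < s := by exact_mod_cast (by omega : 1 < s)
  have hM1 : (1 : ℝ) < (s : ℝ) ^ M := one_lt_pow₀ hs1 (by rintro rfl; simp at hM)
  have hN1 : (1 : ℝ) < (s : ℝ) ^ N := one_lt_pow₀ hs1 (by omega)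
  obtain ⟨hcξ, hξd⟩ := hξJ
  have hcE := ((mem_Eset_iff s c).1 hc).2
  have hdE := ((mem_Eset_iff s d).1 hd).2
  have hξ0 : 0 < ξ := by linarith
  have hz (K : ℕ) (h : m ≤ K) : ∃ z : ℤ, (-(s : ℝ)) ^ K * ξ = z := by
    rw [hξ]; exact neg_pow_mul_div_eq_int hs p h
  obtain ⟨z, hzm⟩ := hz m le_rfl
  have hnot (x : ℝ) (K : ℕ) (hK : 1 ≤ K) (hmK : m ≤ K) (hKm : K ≤ m + 1)
      (hper : (-(s : ℝ)) ^ K * x = x + (-(s : ℝ)) ^ K * ξ) : x ∉ Set.Ioo c d := fun hx =>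
    hgap x hx <| mem_Eset_of_periodic hs (hc0.trans_lt hx.1) (hx.2.le.trans hd1) hK hmK hKm hzm
      hper fun k hk hkm => le_fract_of_endpoints hs (hcE k hk) (hdE k hk) (hmin k hkm) hx
  constructor
  · have hle : c ≤ ξ * (s : ℝ) ^ M / ((s : ℝ) ^ M + 1) := by
      obtain ⟨y, hy⟩ := hz M hmM
      have h1 := fract_le_of_sub_eq_int (a := (-(s : ℝ)) ^ M * c) (b := (s : ℝ) ^ M * (ξ - c))
        (z := y) (mul_nonneg (by linarith) (by linarith)) (by rw [← hy, hM.neg_pow]; ring)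
      rw [le_div_iff₀ (by linarith)]
      linarith [hcE M hM.pos]
    by_contra hne
    refine hnot _ M hM.pos hmM hMm ?_ ⟨lt_of_le_of_ne hle hne, lt_trans ?_ hξd⟩
    · rw [hM.neg_pow]
      field_simp
      ring
    · rw [div_lt_iff₀ (by linarith)]
      linarith
  · have hN1' : (0 : ℝ) < (s : ℝ) ^ N - 1 := by linarith
    have hle : ξ * (s : ℝ) ^ N / ((s : ℝ) ^ N - 1) ≤ d := by
      obtain ⟨y, hy⟩ := hz N hmN
      have h1 := fract_le_of_sub_eq_int (a := (-(s : ℝ)) ^ N * d) (b := (s : ℝ) ^ N * (d - ξ))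
        (z := y) (mul_nonneg (by linarith) (by linarith)) (by rw [← hy, hN.neg_pow]; ring)
      rw [div_le_iff₀ hN1']
      linarith [hdE N hN0]
    by_contra hne
    refine hnot _ N hN0 hmN hNm ?_ ⟨lt_trans hcξ ?_, lt_of_le_of_ne hle (Ne.symm hne)⟩
    · rw [hN.neg_pow]
      field_simp
      ring
    · rw [lt_div_iff₀ hN1']
      linarith

/-- The endpoints of a component of `[0, s/(s+1)] \ E` belong to `E`. -/
theorem component_endpoints {s : ℕ} {c d γ : ℝ}
    (hγ : γ ∈ Set.Icc (0 : ℝ) ((s : ℝ) / (s + 1)) \ Eset s)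
    (hJ : Set.Ioo c d =
      connectedComponentIn (Set.Icc (0 : ℝ) ((s : ℝ) / (s + 1)) \ Eset s) γ) :
    c < d ∧ 0 ≤ c ∧ d ≤ (s : ℝ) / (s + 1) ∧ c ∈ Eset s ∧ d ∈ Eset s ∧
      ∀ x ∈ Set.Ioo c d, x ∉ Eset s := by
  have hγJ : γ ∈ Set.Ioo c d := hJ ▸ mem_connectedComponentIn hγ
  have hcd : c < d := hγJ.1.trans hγJ.2
  have hsub : Set.Ioo c d ⊆ Set.Icc (0 : ℝ) ((s : ℝ) / (s + 1)) \ Eset s :=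
    hJ ▸ connectedComponentIn_subset _ _
  have hIcc : Set.Icc c d ⊆ Set.Icc (0 : ℝ) ((s : ℝ) / (s + 1)) := by
    rw [← closure_Ioo hcd.ne]
    exact closure_minimal (hsub.trans Set.sdiff_subset) isClosed_Icc
  have hext (t : Set ℝ) (ht : IsPreconnected t) (hγt : γ ∈ t) (htI : t ⊆ Set.Icc c d)
      (htE : ∀ x ∈ t, x ∉ Eset s) : t ⊆ Set.Ioo c d := by
    rw [hJ]
    exact ht.subset_connectedComponentIn hγt fun x hx => ⟨hIcc (htI hx), htE x hx⟩
  refine ⟨hcd, (hIcc (Set.left_mem_Icc.2 hcd.le)).1, (hIcc (Set.right_mem_Icc.2 hcd.le)).2,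
    ?_, ?_, fun x hx => (hsub hx).2⟩
  · by_contra h
    refine lt_irrefl c (hext (Set.Ico c d) isPreconnected_Ico ⟨hγJ.1.le, hγJ.2⟩
      Set.Ico_subset_Icc_self (fun x hx => ?_) (Set.left_mem_Ico.2 hcd)).1
    rcases hx.1.eq_or_lt with rfl | h'
    exacts [h, (hsub ⟨h', hx.2⟩).2]
  · by_contra h
    refine lt_irrefl d (hext (Set.Ioc c d) isPreconnected_Ioc ⟨hγJ.1, hγJ.2.le⟩
      Set.Ioc_subset_Icc_self (fun x hx => ?_) (Set.right_mem_Ioc.2 hcd)).2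
    rcases hx.2.eq_or_lt with rfl | h'
    exacts [h, (hsub ⟨hx.1, h'⟩).2]

theorem exists_div_pow_mem_Ioo {s : ℕ} (hs : 2 ≤ s) {c d : ℝ} (hc : 0 ≤ c) (hcd : c < d) :
    ∃ m p : ℕ, (p : ℝ) / (s : ℝ) ^ m ∈ Set.Ioo c d := by
  have hs1 : (1 : ℝ) < s := by exact_mod_cast (by omega : 1 < s)
  obtain ⟨m, hm⟩ := pow_unbounded_of_one_lt (1 / (d - c)) hs1
  have hp : (0 : ℝ) < (s : ℝ) ^ m := by positivity
  rw [div_lt_iff₀ (by linarith)] at hm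
  refine ⟨m, ⌊(s : ℝ) ^ m * c⌋₊ + 1, ?_, ?_⟩ <;> push_cast
  · rw [lt_div_iff₀ hp]
    linarith [Nat.lt_floor_add_one ((s : ℝ) ^ m * c)]
  · rw [div_lt_iff₀ hp]
    linarith [Nat.floor_le (mul_nonneg hp.le hc)]

theorem sval_nil (s : ℕ) : sval s [] = 0 := rfl

theorem sval_cons (s a : ℕ) (w : List ℕ) : sval s (a :: w) = ((a : ℝ) + sval s w) / s := rfl

theorem sval_append {s : ℕ} (hs : s ≠ 0) (u w : List ℕ) :
    sval s (u ++ w) = sval s u + sval s w / (s : ℝ) ^ u.length := by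
  have hs0 : (s : ℝ) ≠ 0 := by exact_mod_cast hs
  induction u with
  | nil => simp [sval_nil]
  | cons a u ih =>
    rw [List.cons_append, sval_cons, sval_cons, ih, List.length_cons, pow_succ]
    field_simp
    ring

theorem sval_flipw {s : ℕ} (hs : s ≠ 0) {v : List ℕ} (hv : ∀ e ∈ v, e < s) :
    sval s (flipw s v) = 1 - 1 / (s : ℝ) ^ v.length - sval s v := by
  have hs0 : (s : ℝ) ≠ 0 := by exact_mod_cast hs
  induction v with
  | nil => simp [flipw, sval_nil]
  | cons a u ih =>
    have ha : a < s := hv a (by simp)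
    have ih' := ih fun e he => hv e (by simp [he])
    simp only [flipw, List.map_cons] at ih' ⊢
    rw [sval_cons, sval_cons, ih', List.length_cons, pow_succ, Nat.sub_sub,
      Nat.cast_sub (by omega)]
    push_cast
    field_simp
    ring

theorem pval_flipw_append {s : ℕ} (hs : 2 ≤ s) {v : List ℕ} (hv : ∀ e ∈ v, e < s)
    (hv0 : v ≠ []) :
    pval s (flipw s v ++ v) =
      (1 - sval s v) * (s : ℝ) ^ v.length / ((s : ℝ) ^ v.length + 1) := by
  have hs1 : (1 : ℝ) < s := by exact_mod_cast (by omega : 1 < s)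
  have h1 : (1 : ℝ) < (s : ℝ) ^ v.length := one_lt_pow₀ hs1 (by simpa using hv0)
  have hlen : (flipw s v).length = v.length := by simp [flipw]
  rw [pval, sval_append (by omega), sval_flipw (by omega) hv, List.length_append, hlen, pow_add]
  generalize (s : ℝ) ^ v.length = q at h1
  have h2 : q * q - 1 ≠ 0 := by nlinarith
  have h3 : q + 1 ≠ 0 := by linarith
  have h4 : q ≠ 0 := by linarith
  rw [div_eq_div_iff h2 h3]
  field_simp
  ring

theorem exists_sval_eq {s : ℕ} (hs : s ≠ 0) (n p : ℕ) (hp : p < s ^ n) :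
    ∃ w : List ℕ, (∀ e ∈ w, e < s) ∧ w.length = n ∧ sval s w = (p : ℝ) / (s : ℝ) ^ n := by
  have hs0 : (s : ℝ) ≠ 0 := by exact_mod_cast hs
  induction n generalizing p with
  | zero => exact ⟨[], by simp, rfl, by simp_all [sval_nil]⟩
  | succ n ih =>
    have hpos : 0 < s ^ n := pow_pos (Nat.pos_of_ne_zero hs) n
    obtain ⟨w, hw, hl, hv⟩ := ih (p % s ^ n) (Nat.mod_lt _ hpos)
    have hlt : p / s ^ n < s := Nat.div_lt_of_lt_mul (by rwa [← pow_succ])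
    refine ⟨p / s ^ n :: w, ?_, by simp [hl], ?_⟩
    · simpa [hlt] using hw
    · have h : (p : ℝ) = (s : ℝ) ^ n * (p / s ^ n : ℕ) + (p % s ^ n : ℕ) := by
        exact_mod_cast (Nat.div_add_mod p (s ^ n)).symm
      rw [sval_cons, hv, h, pow_succ]
      field_simp

theorem exists_sval_eq_div {s : ℕ} (hs : s ≠ 0) (w : List ℕ) :
    ∃ p : ℕ, sval s w = (p : ℝ) / (s : ℝ) ^ w.length := by
  have hs0 : (s : ℝ) ≠ 0 := by exact_mod_cast hs
  induction w with
  | nil => exact ⟨0, by simp [sval_nil]⟩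
  | cons a w ih =>
    obtain ⟨p, hp⟩ := ih
    refine ⟨a * s ^ w.length + p, ?_⟩
    rw [sval_cons, hp, List.length_cons, pow_succ]
    push_cast
    field_simp

theorem exists_expansion {s : ℕ} (hs : s ≠ 0) {m n p : ℕ} (hmn : m ≤ n)
    (hp : (p : ℝ) / (s : ℝ) ^ m < 1) :
    ∃ w : List ℕ, (∀ e ∈ w, e < s) ∧ w.length = n ∧ sval s w = (p : ℝ) / (s : ℝ) ^ m := by
  have hs0 : (0 : ℝ) < s := by exact_mod_cast Nat.pos_of_ne_zero hs
  rw [div_lt_one (by positivity)] at hp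
  have hp' : p < s ^ m := by exact_mod_cast hp
  obtain ⟨e, rfl⟩ := Nat.exists_eq_add_of_le hmn
  obtain ⟨w, h1, h2, h3⟩ := exists_sval_eq hs (m + e) (p * s ^ e) (by
    rw [pow_add]
    exact Nat.mul_lt_mul_of_pos_right hp' (pow_pos (Nat.pos_of_ne_zero hs) e))
  refine ⟨w, h1, h2, ?_⟩
  rw [h3, pow_add]
  push_cast
  field_simp

theorem MinDen.eq {s : ℕ} {x : ℝ} {m n : ℕ} (hm : MinDen s x m) (hn : MinDen s x n) : m = n :=
  le_antisymm (hm.2 n hn.1) (hn.2 m hm.1)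

theorem MinDen.one_sub {s : ℕ} (hs : s ≠ 0) {x : ℝ} {m : ℕ} (h0 : 0 ≤ x) (h1 : x ≤ 1)
    (h : MinDen s x m) : MinDen s (1 - x) m := by
  have hs0 : (0 : ℝ) < s := by exact_mod_cast Nat.pos_of_ne_zero hs
  have key (y : ℝ) (hy1 : y ≤ 1) (n : ℕ) (hy : ∃ p : ℕ, y = (p : ℝ) / (s : ℝ) ^ n) :
      ∃ p : ℕ, 1 - y = (p : ℝ) / (s : ℝ) ^ n := by
    obtain ⟨p, rfl⟩ := hy
    rw [div_le_one (by positivity)] at hy1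
    have hp : p ≤ s ^ n := by exact_mod_cast hy1
    refine ⟨s ^ n - p, ?_⟩
    rw [Nat.cast_sub hp]
    push_cast
    field_simp
  refine ⟨key x h1 m h.1, fun n hn => h.2 n ?_⟩
  simpa using key (1 - x) (by linarith) n hn

theorem IsEvenExp.length_bounds {s : ℕ} (hs : s ≠ 0) {x : ℝ} {m : ℕ} {w : List ℕ} (h1 : x < 1)
    (hm : MinDen s x m) (hw : IsEvenExp s x w) : m ≤ w.length ∧ w.length ≤ m + 1 := by
  obtain ⟨-, -, -, hval, hmin⟩ := hw
  refine ⟨hm.2 _ (hval ▸ exists_sval_eq_div hs w), ?_⟩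
  obtain ⟨p, rfl⟩ := hm.1
  rcases Nat.even_or_odd m with he | ho
  · obtain ⟨u, hu1, hu2, hu3⟩ := exists_expansion hs le_rfl h1
    have := hmin u hu1 (hu2 ▸ he) hu3
    omega
  · obtain ⟨u, hu1, hu2, hu3⟩ := exists_expansion hs (Nat.le_succ m) h1
    have := hmin u hu1 (hu2 ▸ ho.add_one) hu3
    omega

theorem IsOddExp.length_bounds {s : ℕ} (hs : s ≠ 0) {x : ℝ} {m : ℕ} {v : List ℕ} (h1 : x < 1)
    (hm : MinDen s x m) (hv : IsOddExp s x v) : m ≤ v.length ∧ v.length ≤ m + 1 := by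
  obtain ⟨-, -, hval, hmin⟩ := hv
  refine ⟨hm.2 _ (hval ▸ exists_sval_eq_div hs v), ?_⟩
  obtain ⟨p, rfl⟩ := hm.1
  rcases Nat.even_or_odd m with he | ho
  · obtain ⟨u, hu1, hu2, hu3⟩ := exists_expansion hs (Nat.le_succ m) h1
    have := hmin u hu1 (hu2 ▸ he.add_one) hu3
    omega
  · obtain ⟨u, hu1, hu2, hu3⟩ := exists_expansion hs le_rfl h1
    have := hmin u hu1 (hu2 ▸ ho) hu3
    omega

/-- every connected component `J = (c,d)` of `[0, s/(s+1)] \ E` contains a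
unique `s`-adic rational `ξ` of minimal denominator (the pseudocenter); moreover
(i) `c = ξ_L` and `d = ξ_R`; (ii) `g^k(ξ) ∉ (0, d)` for all `k ≥ 1`; (iii) any
`ξ' ∈ ℚ_s ∩ J` with `g^k(ξ') ∉ (0, ξ')` for all `k ≥ 1` equals `ξ`. -/
theorem pseudocenter_of_component
    (s : ℕ) (hs : 2 ≤ s) (c d γ : ℝ)
    (hγ : γ ∈ Set.Icc (0 : ℝ) ((s : ℝ) / (s + 1)) \ Eset s)
    (hJ : Set.Ioo c d =
      connectedComponentIn (Set.Icc (0 : ℝ) ((s : ℝ) / (s + 1)) \ Eset s) γ) :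
    ∃ ξ ∈ Set.Ioo c d, IsSAdic s ξ ∧
      (∀ m m' : ℕ, MinDen s ξ m →
        ∀ ξ' ∈ Set.Ioo c d, IsSAdic s ξ' → ξ' ≠ ξ → MinDen s ξ' m' → m < m') ∧
      (∀ w v : List ℕ, IsEvenExp s ξ w → IsOddExp s (1 - ξ) v →
        c = pval s (flipw s v ++ v) ∧ d = pval s w) ∧
      (∀ k : ℕ, 1 ≤ k → (gmap s)^[k] ξ ∉ Set.Ioo 0 d) ∧
      (∀ ξ' ∈ Set.Ioo c d, IsSAdic s ξ' →
        (∀ k : ℕ, 1 ≤ k → (gmap s)^[k] ξ' ∉ Set.Ioo 0 ξ') → ξ' = ξ) := by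
  have hs0 : s ≠ 0 := by omega
  have hs2 : (2 : ℝ) ≤ s := by exact_mod_cast hs
  obtain ⟨hcd, hc0, hd1, hc, hd, hgap⟩ := component_endpoints hγ hJ
  have hd1' : d < 1 := hd1.trans_lt (by rw [div_lt_one (by linarith)]; linarith)
  classical
  have hex := exists_div_pow_mem_Ioo hs hc0 hcd
  obtain ⟨m, ⟨p, hp⟩, hmin⟩ : ∃ m, (∃ p : ℕ, (p : ℝ) / (s : ℝ) ^ m ∈ Set.Ioo c d) ∧
      ∀ k < m, ¬ ∃ p : ℕ, (p : ℝ) / (s : ℝ) ^ k ∈ Set.Ioo c d :=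
    ⟨Nat.find hex, Nat.find_spec hex, fun k hk => Nat.find_min hex hk⟩
  have hminZ : ∀ k < m, ∀ j : ℤ, (j : ℝ) / (s : ℝ) ^ k ∉ Set.Ioo c d := by
    intro k hk j hj
    have hpos : (0 : ℝ) < (s : ℝ) ^ k := by positivity
    have hj0 : (0 : ℝ) < j := (div_pos_iff_of_pos_right hpos).1 (hc0.trans_lt hj.1)
    lift j to ℕ using by exact_mod_cast hj0.le
    exact hmin k hk ⟨j, by rwa [Int.cast_natCast] at hj⟩
  obtain ⟨ξ, hξ⟩ : ∃ ξ : ℝ, ξ = (p : ℝ) / (s : ℝ) ^ m := ⟨_, rfl⟩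
  rw [← hξ] at hp
  have hξ0 : 0 < ξ := hc0.trans_lt hp.1
  have hξ1 : ξ < 1 := hp.2.trans hd1'
  have hden : MinDen s ξ m := ⟨⟨p, hξ⟩, fun n ⟨q, hq⟩ => not_lt.1 fun hn =>
    hmin n hn ⟨q, hq ▸ hp⟩⟩
  have hm0 : m ≠ 0 := by
    rintro rfl
    rw [pow_zero, div_one] at hξ
    have h0 : 0 < p := by exact_mod_cast hξ ▸ hξ0
    have h1 : p < 1 := by exact_mod_cast hξ ▸ hξ1
    omega
  obtain ⟨M, hMo, hmM, hMm⟩ : ∃ M, Odd M ∧ m ≤ M ∧ M ≤ m + 1 := by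
    rcases Nat.even_or_odd m with h | h
    exacts [⟨m + 1, h.add_one, by omega, le_rfl⟩, ⟨m, h, le_rfl, by omega⟩]
  obtain ⟨N, hNe, hmN, hNm⟩ : ∃ N, Even N ∧ m ≤ N ∧ N ≤ m + 1 := by
    rcases Nat.even_or_odd m with h | h
    exacts [⟨m, h, le_rfl, by omega⟩, ⟨m + 1, h.add_one, by omega, le_rfl⟩]
  have hends (M N : ℕ) (hMo : Odd M) (hmM : m ≤ M) (hMm : M ≤ m + 1) (hNe : Even N)
      (hmN : m ≤ N) (hNm : N ≤ m + 1) := gap_endpoints hs hc0 hd1 hc hd hgap hξ hp hminZ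
    hMo hmM hMm hNe (by omega) hmN hNm
  obtain ⟨hcM, hdN⟩ := hends M N hMo hmM hMm hNe hmN hNm
  have hm1 : (1 : ℝ) < (s : ℝ) ^ m := one_lt_pow₀ (by linarith) hm0
  have hM1 : (s : ℝ) ^ m ≤ (s : ℝ) ^ M := pow_le_pow_right₀ (by linarith) hmM
  have hN1 : (s : ℝ) ^ m ≤ (s : ℝ) ^ N := pow_le_pow_right₀ (by linarith) hmN
  have hleft (x : ℝ) (hx : x ∈ Set.Ioo c d) : (s : ℝ) ^ M * (ξ - x) < x := by
    have := hx.1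
    rw [hcM, div_lt_iff₀ (by linarith)] at this
    linarith
  have hright (x : ℝ) (hx : x ∈ Set.Ioo c d) : (s : ℝ) ^ N * (x - ξ) < x := by
    have := hx.2
    rw [hdN, lt_div_iff₀ (by linarith)] at this
    linarith
  refine ⟨ξ, hp, ⟨p, m, hξ⟩, ?_, ?_, ?_, ?_⟩
  · rintro n m' hn x hx - hne hm'
    obtain rfl := hden.eq hn
    obtain ⟨q, hq⟩ := hm'.1
    refine lt_of_le_of_ne (not_lt.1 fun h => hmin m' h ⟨q, hq ▸ hx⟩) ?_
    rintro rfl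
    have hpm : ξ * (s : ℝ) ^ m = p := by rw [hξ]; field_simp
    have hqm : x * (s : ℝ) ^ m = q := by rw [hq]; field_simp
    have hx1 : x < 1 := hx.2.trans hd1'
    rcases lt_or_gt_of_ne hne with h | h
    · have hlt : (q : ℝ) < p := by rw [← hpm, ← hqm]; gcongr
      have hle : (q : ℝ) + 1 ≤ p := by exact_mod_cast hlt
      nlinarith [hleft x hx]
    · have hlt : (p : ℝ) < q := by rw [← hpm, ← hqm]; gcongr
      have hle : (p : ℝ) + 1 ≤ q := by exact_mod_cast hlt
      nlinarith [hright x hx]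
  · intro w v hw hv
    obtain ⟨hw1, hw2⟩ := hw.length_bounds hs0 hξ1 hden
    obtain ⟨hv1, hv2⟩ := hv.length_bounds hs0 (by linarith) (hden.one_sub hs0 hξ0.le hξ1.le)
    obtain ⟨-, -, hwe, hwval, -⟩ := hw
    obtain ⟨hvd, hvo, hvval, -⟩ := hv
    obtain ⟨h1, h2⟩ := hends v.length w.length hvo hv1 hv2 hwe hw1 hw2
    rw [pval_flipw_append hs hvd (by rintro rfl; simp at hvo), hvval, pval, hwval,
      sub_sub_cancel]
    exact ⟨h1, h2⟩
  · intro k hk hmem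
    rw [gmap_iterate s ξ hk] at hmem
    rcases lt_or_ge k m with h | h
    · have hle := le_fract_of_endpoints hs (((mem_Eset_iff s c).1 hc).2 k hk)
        (((mem_Eset_iff s d).1 hd).2 k hk) (hminZ k h) hp
      have hfr : ((p * (-1) ^ k - s ^ (m - k) * ⌊(-(s : ℝ)) ^ k * ξ⌋ : ℤ) : ℝ) /
          (s : ℝ) ^ (m - k) = Int.fract ((-(s : ℝ)) ^ k * ξ) := by
        have hsm : (s : ℝ) ^ m = (s : ℝ) ^ k * (s : ℝ) ^ (m - k) := by
          rw [← pow_add, Nat.add_sub_cancel' h.le]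
        rw [Int.fract]
        generalize ⌊(-(s : ℝ)) ^ k * ξ⌋ = f
        rw [hξ, hsm, neg_pow (s : ℝ)]
        push_cast
        generalize (-1 : ℝ) ^ k = t
        field_simp
      refine absurd ?_ (hminZ (m - k) (by omega)
        (p * (-1) ^ k - s ^ (m - k) * ⌊(-(s : ℝ)) ^ k * ξ⌋))
      rw [hfr]
      exact ⟨hp.1.trans_le hle, hmem.2⟩
    · obtain ⟨z, hz⟩ := neg_pow_mul_div_eq_int hs p h
      rw [Int.cast_natCast, ← hξ] at hz
      rw [hz, Int.fract_intCast] at hmem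
      exact lt_irrefl _ hmem.1
  · intro x hx _ hk
    have hx1 : x < 1 := hx.2.trans hd1'
    by_contra hne
    rcases lt_or_gt_of_ne hne with h | h
    · refine hk M hMo.pos ?_
      obtain ⟨z, hz⟩ := neg_pow_mul_div_eq_int hs p hmM
      rw [Int.cast_natCast, ← hξ] at hz
      have hpos : 0 < (s : ℝ) ^ M * (ξ - x) := mul_pos (by linarith) (by linarith)
      have hfr : Int.fract ((-(s : ℝ)) ^ M * x) = (s : ℝ) ^ M * (ξ - x) :=
        Int.fract_eq_iff.2 ⟨hpos.le, (hleft x hx).trans hx1, z, by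
          rw [← hz, hMo.neg_pow]; ring⟩
      rw [gmap_iterate s x hMo.pos, hfr]
      exact ⟨hpos, hleft x hx⟩
    · refine hk N (by omega) ?_
      obtain ⟨z, hz⟩ := neg_pow_mul_div_eq_int hs p hmN
      rw [Int.cast_natCast, ← hξ] at hz
      have hpos : 0 < (s : ℝ) ^ N * (x - ξ) := mul_pos (by linarith) (by linarith)
      have hfr : Int.fract ((-(s : ℝ)) ^ N * x) = (s : ℝ) ^ N * (x - ξ) :=
        Int.fract_eq_iff.2 ⟨hpos.le, (hright x hx).trans hx1, z, by
          rw [← hz, hNe.neg_pow]; ring⟩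
      rw [gmap_iterate s x (by omega), hfr]
      exact ⟨hpos, hright x hx⟩
end
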